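/- Let d ≥ 1, let E := EuclideanSpace ℝ (Fin d), and let X ⊆ E be an (r,R)-Delone set of finite local complexity. Then X is repetitive if and only if the hull relation is symmetric on Ω(X): for every Y ∈ Ω(X) one has X ∈ Ω(Y). (This is the combinatorial form of the statement that the translation dynamical system on the continuous hull of X is minimal if and only if X is repetitive.) -/

import Mathlib

noncomputable section

/-- The Euclidean space `ℝ^d`. -/
abbrev Ee (d : ℕ) := EuclideanSpace ℝ (Fin d)

/-- `X` is an `(r, R)`-Delone set in `ℝ^d`: every open ball of radius `r` contains at most
one point of `X`, and every open ball of radius `R` contains at least one point of `X`. -/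
def IsDelone {d : ℕ} (r R : ℝ) (X : Set (Ee d)) : Prop :=
  (∀ z : Ee d, (X ∩ Metric.ball z r).Subsingleton) ∧
    (∀ z : Ee d, (X ∩ Metric.ball z R).Nonempty)

/-- The (open) Voronoi cell of a point `y` of a Delone set `X`: the points strictly closer
to `y` than to any other point of `X`. -/
def voronoiCell {d : ℕ} (X : Set (Ee d)) (y : Ee d) : Set (Ee d) :=
  {z : Ee d | ∀ x ∈ X, x ≠ y → dist z y < dist z x}

/-- The translate `S − x = {p − x | p ∈ S}` of a subset `S` of `ℝ^d`. -/
def setTranslate {d : ℕ} (S : Set (Ee d)) (x : Ee d) : Set (Ee d) :=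
  (fun p => p - x) '' S

/-- `X` has finite local complexity (finite `ℝ^d`-type): for every `ρ > 0` there are only
finitely many translated patches `(X − x) ∩ Metric.closedBall 0 ρ` with `x ∈ X`. -/
def HasFLC {d : ℕ} (X : Set (Ee d)) : Prop :=
  ∀ ρ : ℝ, 0 < ρ →
    {P : Set (Ee d) | ∃ x ∈ X, P = setTranslate X x ∩ Metric.closedBall 0 ρ}.Finite

/-- The local-isomorphism hull of `Z ⊆ ℝ^d`: the sets `Y` all of whose patches appear,
up to translation, as patches of `Z`. -/
def hull {d : ℕ} (Z : Set (Ee d)) : Set (Set (Ee d)) :=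
  {Y : Set (Ee d) | ∀ z : Ee d, ∀ ρ : ℝ, 0 < ρ → ∃ w : Ee d,
    setTranslate Y z ∩ Metric.closedBall 0 ρ = setTranslate Z w ∩ Metric.closedBall 0 ρ}

/-- The canonical transversal of `X`: the elements of the hull of `X` containing `0`. -/
def Transversal {d : ℕ} (X : Set (Ee d)) : Type :=
  {Y : Set (Ee d) // Y ∈ hull X ∧ (0 : Ee d) ∈ Y}

/-- The patch topology on the canonical transversal, generated by the sets
`U(ρ, P) = {Y | Y ∩ Metric.closedBall 0 ρ = P}` for `ρ > 0` and `P ⊆ ℝ^d`. -/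
instance patchTopology {d : ℕ} (X : Set (Ee d)) : TopologicalSpace (Transversal X) :=
  TopologicalSpace.generateFrom
    {U : Set (Transversal X) | ∃ ρ : ℝ, 0 < ρ ∧ ∃ P : Set (Ee d),
      U = {Y : Transversal X | Y.1 ∩ Metric.closedBall 0 ρ = P}}

/-- `X` is repetitive: for every `ρ > 0` there is `L > 0` such that every patch of radius
`ρ` of `X` reappears, up to translation, within distance `L` of every point of `ℝ^d`. -/
def IsRepetitive {d : ℕ} (X : Set (Ee d)) : Prop :=
  ∀ ρ : ℝ, 0 < ρ → ∃ L : ℝ, 0 < L ∧ ∀ x ∈ X, ∀ z : Ee d, ∃ y ∈ X,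
    dist y z ≤ L ∧
      setTranslate X y ∩ Metric.closedBall 0 ρ = setTranslate X x ∩ Metric.closedBall 0 ρ

theorem mem_setTranslate {d : ℕ} {S : Set (Ee d)} {x p : Ee d} :
    p ∈ setTranslate S x ↔ p + x ∈ S := by
  simp [setTranslate, sub_eq_iff_eq_add]

/-- Agreement of two patches passes to the smaller patches with shifted centres. -/
theorem setTranslate_inter_closedBall_add {d : ℕ} {A B : Set (Ee d)} {a b : Ee d} {ρ' : ℝ}
    (h : setTranslate A a ∩ Metric.closedBall 0 ρ' = setTranslate B b ∩ Metric.closedBall 0 ρ')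
    (v : Ee d) {ρ : ℝ} (hv : ‖v‖ + ρ ≤ ρ') :
    setTranslate A (a + v) ∩ Metric.closedBall 0 ρ =
      setTranslate B (b + v) ∩ Metric.closedBall 0 ρ := by
  ext p
  simp only [Set.mem_inter_iff, mem_setTranslate, mem_closedBall_zero_iff]
  refine and_congr_left fun hp => ?_
  have hpv : ‖p + v‖ ≤ ρ' := (norm_add_le p v).trans (by linarith)
  have := Set.ext_iff.mp h (p + v)
  simp only [Set.mem_inter_iff, mem_setTranslate, mem_closedBall_zero_iff, hpv, and_true] at this
  rwa [add_comm a v, add_comm b v, ← add_assoc, ← add_assoc]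

theorem HasFLC.exists_eventually_patch_eq {d : ℕ} {X : Set (Ee d)} (hX : HasFLC X)
    {ι : Type*} (U : Ultrafilter ι) {x : ι → Ee d} (hx : ∀ i, x i ∈ X) {ρ : ℝ} (hρ : 0 < ρ) :
    ∃ P, ∀ᶠ i in U, setTranslate X (x i) ∩ Metric.closedBall 0 ρ = P := by
  have h := (Ultrafilter.eventually_exists_mem_iff (f := U) (hX ρ hρ)
    (P := fun P i => setTranslate X (x i) ∩ Metric.closedBall 0 ρ = P)).1
    (Filter.Eventually.of_forall fun i => ⟨_, ⟨x i, hx i, rfl⟩, rfl⟩)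
  exact h.imp fun P hP => hP.2

/-- Under finite local complexity, the translates of `X` centred at its points have limits
along ultrafilters, in the sense of agreement on arbitrarily large balls. -/
theorem HasFLC.exists_limit {d : ℕ} {X : Set (Ee d)} (hX : HasFLC X)
    {ι : Type*} (U : Ultrafilter ι) {x : ι → Ee d} (hx : ∀ i, x i ∈ X) :
    ∃ Y : Set (Ee d), ∀ ρ : ℝ, 0 < ρ → ∀ᶠ i in U,
      setTranslate Y 0 ∩ Metric.closedBall 0 ρ =
        setTranslate X (x i) ∩ Metric.closedBall 0 ρ := by
  refine ⟨{p | ∀ᶠ i in U, p ∈ setTranslate X (x i)}, fun ρ hρ => ?_⟩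
  obtain ⟨P, hP⟩ := hX.exists_eventually_patch_eq U hx hρ
  have hY : setTranslate {p | ∀ᶠ i in U, p ∈ setTranslate X (x i)} 0 ∩
      Metric.closedBall 0 ρ = P := by
    ext p
    rw [Set.mem_inter_iff, mem_setTranslate, add_zero, Set.mem_ofPred_eq]
    constructor
    · rintro ⟨hp, hpρ⟩
      obtain ⟨i, hi, rfl⟩ := (hp.and hP).exists
      exact ⟨hi, hpρ⟩
    · intro hp
      have hmem : ∀ᶠ i in U, p ∈ setTranslate X (x i) ∩ Metric.closedBall 0 ρ :=
        hP.mono fun i hi => by rwa [hi]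
      exact ⟨hmem.mono fun i hi => hi.1, hmem.exists.choose_spec.2⟩
  exact hP.mono fun i hi => hY.trans hi.symm

theorem mem_hull_of_isRepetitive {d : ℕ} {X Y : Set (Ee d)} (hne : X.Nonempty)
    (hX : IsRepetitive X) (hY : Y ∈ hull X) : X ∈ hull Y := by
  intro z ρ hρ
  obtain ⟨x, hx⟩ := hne
  obtain ⟨L, hL, h⟩ := hX (‖z - x‖ + ρ) (by positivity)
  obtain ⟨w, hw⟩ := hY 0 (L + (‖z - x‖ + ρ)) (by positivity)
  obtain ⟨y, -, hyw, hyx⟩ := h x hx w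
  rw [dist_eq_norm] at hyw
  have hYX := setTranslate_inter_closedBall_add hw (y - w) (ρ := ‖z - x‖ + ρ) (by linarith)
  rw [add_sub_cancel w y] at hYX
  have hXY := setTranslate_inter_closedBall_add (hYX.trans hyx).symm (z - x) le_rfl
  rw [add_sub_cancel x z] at hXY
  exact ⟨_, hXY⟩

theorem isRepetitive_of_hull_symmetric {d : ℕ} {R : ℝ} {X : Set (Ee d)}
    (hX : ∀ z : Ee d, (X ∩ Metric.ball z R).Nonempty) (hFLC : HasFLC X)
    (hsymm : ∀ Y ∈ hull X, X ∈ hull Y) : IsRepetitive X := by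
  by_contra hrep
  obtain ⟨ρ, hρ, hbad⟩ : ∃ ρ : ℝ, 0 < ρ ∧ ∀ L : ℝ, 0 < L → ∃ x ∈ X, ∃ z : Ee d, ∀ y ∈ X,
      dist y z ≤ L → setTranslate X y ∩ Metric.closedBall 0 ρ ≠
        setTranslate X x ∩ Metric.closedBall 0 ρ := by
    unfold IsRepetitive at hrep
    push Not at hrep
    exact hrep
  choose a ha z hz using fun n : ℕ => hbad (n + 1) (by positivity)
  choose c hc using fun n => hX (z n)
  let U : Ultrafilter ℕ := Filter.hyperfilter ℕ
  obtain ⟨P, hP⟩ := hFLC.exists_eventually_patch_eq U ha hρ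
  obtain ⟨Y, hY⟩ := hFLC.exists_limit U fun n => (hc n).1
  have hYX : Y ∈ hull X := by
    intro v σ hσ
    obtain ⟨n, hn⟩ := (hY (‖v‖ + σ) (by positivity)).exists
    have := setTranslate_inter_closedBall_add hn v le_rfl
    rw [zero_add] at this
    exact ⟨_, this⟩
  obtain ⟨m, hm⟩ := hP.exists
  obtain ⟨w, hw⟩ := hsymm Y hYX (a m) ρ hρ
  have hlarge : ∀ᶠ n : ℕ in U, ‖w‖ + R ≤ n :=
    (tendsto_natCast_atTop_atTop.eventually_ge_atTop (‖w‖ + R)).filter_mono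
      Nat.hyperfilter_le_atTop
  obtain ⟨n, hnY, hnP, hn⟩ :=
    ((hY (‖w‖ + ρ) (by positivity)).and (hP.and hlarge)).exists
  have hpatch := setTranslate_inter_closedBall_add hnY w le_rfl
  rw [zero_add, ← hw, hm] at hpatch
  have hzero : (0 : Ee d) ∈ setTranslate X (c n + w) ∩ Metric.closedBall 0 ρ := by
    rw [← hpatch, ← hm, Set.mem_inter_iff, mem_setTranslate, zero_add]
    exact ⟨ha m, Metric.mem_closedBall_self hρ.le⟩
  have hmem : c n + w ∈ X := by simpa using mem_setTranslate.1 hzero.1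
  refine hz n _ hmem ?_ (hpatch.symm.trans hnP.symm)
  have hcz : dist (c n) (z n) < R := (hc n).2
  calc dist (c n + w) (z n) ≤ dist (c n + w) (c n) + dist (c n) (z n) := dist_triangle _ _ _
    _ ≤ n + 1 := by rw [dist_self_add_left]; linarith

/-- An `(r,R)`-Delone set `X` in `ℝ^d` of finite local complexity is
repetitive if and only if the hull relation is symmetric on `Ω(X)`: every `Y ∈ Ω(X)`
satisfies `X ∈ Ω(Y)`.  (Combinatorial form of: the translation dynamical system on the
continuous hull is minimal iff `X` is repetitive.) -/
theorem repetitive_iff_hull_symmetric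
    (d : ℕ) (hd : 1 ≤ d) (r R : ℝ) (hr : 0 < r) (hR : 0 < R)
    (X : Set (Ee d)) (hX : IsDelone r R X) (hFLC : HasFLC X) :
    IsRepetitive X ↔ ∀ Y ∈ hull X, X ∈ hull Y := by
  exact ⟨fun h Y hY => mem_hull_of_isRepetitive ((hX.2 0).mono Set.inter_subset_left) h hY,
    isRepetitive_of_hull_symmetric hX.2 hFLC⟩
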